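/- Suppose bimodules _B M _A and _A N _B define a stable equivalence of Morita type of adjoint type between finite dimensional k-algebras A and B. Then A is Gorenstein (i.e. there exists n such that every finitely generated left A-module has Gorenstein projective dimension at most n) if and only if B is Gorenstein, and in that case the global Gorenstein dimensions of A and B (the least such n) are equal. -/

import Mathlib

open CategoryTheory CategoryTheory.Limits

universe v u₁ u₂

section FGGorensteinPrelude

variable {A : Type u₁} [Ring A]

/-- A totally acyclic complex of finitely generated projective modules: each term is a
finitely generated projective module, consecutive differentials compose to zero, the
complex is acyclic, and it stays acyclic after applying `Hom(-, Q)` for every finitely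
generated projective module `Q`. -/
structure IsFGTotallyAcyclic (P : ℤ → ModuleCat.{v} A)
    (d : ∀ n : ℤ, P n ⟶ P (n + 1)) : Prop where
  finite : ∀ n, Module.Finite A (P n)
  projective : ∀ n, Projective (P n)
  comp_eq_zero : ∀ n, d n ≫ d (n + 1) = 0
  exact : ∀ n, (ShortComplex.mk (d n) (d (n + 1)) (comp_eq_zero n)).Exact
  hom_exact : ∀ (Q : ModuleCat.{v} A), Module.Finite A Q → Projective Q → ∀ n,
    Function.Exact (fun g : P (n + 1 + 1) ⟶ Q => d (n + 1) ≫ g)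
      (fun g : P (n + 1) ⟶ Q => d n ≫ g)

/-- A finitely generated module is Gorenstein projective if it is isomorphic to a cycle
of a totally acyclic complex of finitely generated projective modules. -/
def IsFGGorensteinProjective (M : ModuleCat.{v} A) : Prop :=
  Module.Finite A M ∧
    ∃ (P : ℤ → ModuleCat.{v} A) (d : ∀ n : ℤ, P n ⟶ P (n + 1))
      (_ : IsFGTotallyAcyclic P d) (n : ℤ), Nonempty (M ≅ kernel (d n))

/-- `fgPdLE n X` : `X` admits a resolution `0 → P_n → ⋯ → P_0 → X → 0` by finitely
generated projective modules. -/
def fgPdLE : ℕ → ModuleCat.{v} A → Prop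
  | 0, X => Projective X
  | (n + 1), X => ∃ (K P : ModuleCat.{v} A) (i : K ⟶ P) (p : P ⟶ X) (w : i ≫ p = 0),
      Module.Finite A P ∧ Projective P ∧ (ShortComplex.mk i p w).ShortExact ∧ fgPdLE n K

/-- `X` has finite projective dimension (within finitely generated modules). -/
def FGHasFinitePd (X : ModuleCat.{v} A) : Prop := ∃ n, fgPdLE n X

/-- `fgGpdLE n X` : `X` admits a resolution `0 → G_n → ⋯ → G_0 → X → 0` by finitely
generated Gorenstein projective modules. -/
def fgGpdLE : ℕ → ModuleCat.{v} A → Prop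
  | 0, X => IsFGGorensteinProjective X
  | (n + 1), X => ∃ (K G : ModuleCat.{v} A) (i : K ⟶ G) (p : G ⟶ X) (w : i ≫ p = 0),
      IsFGGorensteinProjective G ∧ (ShortComplex.mk i p w).ShortExact ∧ fgGpdLE n K

/-- `X` has finite Gorenstein projective dimension (within finitely generated modules). -/
def FGHasFiniteGpd (X : ModuleCat.{v} A) : Prop := ∃ n, fgGpdLE n X

/-- A morphism factors through a finitely generated projective module. -/
def FactorsThroughFGProjective {X Y : ModuleCat.{v} A} (f : X ⟶ Y) : Prop :=
  ∃ (P : ModuleCat.{v} A) (_ : Module.Finite A P) (_ : Projective P)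
    (a : X ⟶ P) (b : P ⟶ Y), f = a ≫ b

/-- `A` is CM-free: every finitely generated Gorenstein projective `A`-module is
projective. -/
def IsCMFree (A : Type u₁) [Ring A] : Prop :=
  ∀ X : ModuleCat.{v} A, IsFGGorensteinProjective X → Projective X

/-- `X` is a direct summand of `G^n` for some `n`. -/
def IsSummandOfPow (G X : ModuleCat.{v} A) : Prop :=
  ∃ (n : ℕ) (Y : ModuleCat.{v} A), Nonempty ((X ⊞ Y) ≅ ⨁ (fun _ : Fin n => G))

/-- `A` is CM-finite: there is a finitely generated Gorenstein projective `A`-module `G`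
such that every finitely generated Gorenstein projective `A`-module is a direct summand
of `G^n` for some `n`. -/
def IsCMFinite (A : Type u₁) [Ring A] : Prop :=
  ∃ G : ModuleCat.{v} A, IsFGGorensteinProjective G ∧
    ∀ X : ModuleCat.{v} A, IsFGGorensteinProjective X → IsSummandOfPow G X

end FGGorensteinPrelude

section GorensteinStableFrobenius

variable {k : Type u₁} [Field k]

/-- A Gorenstein stable Frobenius pair between two algebras `A` and `B`, encoded on the
(ambient) module categories: a Frobenius pair `(F, H)` (both `(F, H)` and `(H, F)` are
adjoint pairs) of faithful functors preserving finitely generated modules, finitely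
generated projective modules and finitely generated Gorenstein projective modules, such
that the cokernel of the unit at every finitely generated Gorenstein projective module and
the kernel of the counit at every finitely generated module of finite Gorenstein
projective dimension have finite projective dimension.  (Exactness of `F` and `H` is
automatic since each is both a left and a right adjoint.) -/
structure GorensteinStableFrobeniusPair (A : Type u₁) [Ring A] (B : Type u₂) [Ring B]
    (F : ModuleCat.{v} A ⥤ ModuleCat.{v} B) (H : ModuleCat.{v} B ⥤ ModuleCat.{v} A) where
  adj₁ : F ⊣ H
  adj₂ : H ⊣ F
  faithful_F : F.Faithful
  faithful_H : H.Faithful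
  fg_F : ∀ X : ModuleCat.{v} A, Module.Finite A X → Module.Finite B (F.obj X)
  fg_H : ∀ Y : ModuleCat.{v} B, Module.Finite B Y → Module.Finite A (H.obj Y)
  proj_F : ∀ X : ModuleCat.{v} A, Module.Finite A X → Projective X → Projective (F.obj X)
  proj_H : ∀ Y : ModuleCat.{v} B, Module.Finite B Y → Projective Y → Projective (H.obj Y)
  gp_F : ∀ X : ModuleCat.{v} A,
    IsFGGorensteinProjective X → IsFGGorensteinProjective (F.obj X)
  gp_H : ∀ Y : ModuleCat.{v} B,
    IsFGGorensteinProjective Y → IsFGGorensteinProjective (H.obj Y)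
  unit_coker : ∀ X : ModuleCat.{v} A, IsFGGorensteinProjective X →
    FGHasFinitePd (cokernel (adj₁.unit.app X))
  counit_ker : ∀ Y : ModuleCat.{v} B, Module.Finite B Y → FGHasFiniteGpd Y →
    FGHasFinitePd (kernel (adj₁.counit.app Y))

end GorensteinStableFrobenius

section MoritaType

open CategoryTheory CategoryTheory.Limits

/-- The pointwise biproduct of two functors into a category with binary biproducts. -/
noncomputable def biprodFunctor {C : Type*} [Category C] {D : Type*} [Category D]
    [Preadditive D] [HasBinaryBiproducts D] (S T : C ⥤ D) : C ⥤ D where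
  obj X := S.obj X ⊞ T.obj X
  map f := biprod.map (S.map f) (T.map f)
  map_id X := by ext <;> simp
  map_comp f g := by ext <;> simp

/-- Bimodules `_B M _A` and `_A N _B` defining a stable equivalence of Morita type of
adjoint type between `A` and `B`, encoded via their tensor functors `F = M ⊗_A -` and
`H = N ⊗_B -` (Mathlib has no tensor product of bimodules over noncommutative rings).
The requirements are: `(F, H)` and `(H, F)` are adjoint pairs (adjoint type); the
composite `H ∘ F` is naturally isomorphic to `𝟭 ⊕ T_P`, where `T_P = P ⊗_A -` takes only
projective values (because the bimodule `P` is projective) and preserves finitely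
generated modules, and symmetrically `F ∘ H ≅ 𝟭 ⊕ T_Q`; moreover `F` and `H` preserve
finitely generated modules.  (Exactness of `F` and `H`, i.e. projectivity of `M` and `N`
as one-sided modules, is automatic since each functor is both a left and a right
adjoint.) -/
structure StableEquivMoritaAdjointType (A : Type u₁) [Ring A] (B : Type u₂) [Ring B]
    (F : ModuleCat.{v} A ⥤ ModuleCat.{v} B) (H : ModuleCat.{v} B ⥤ ModuleCat.{v} A) where
  adj₁ : F ⊣ H
  adj₂ : H ⊣ F
  TP : ModuleCat.{v} A ⥤ ModuleCat.{v} A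
  TQ : ModuleCat.{v} B ⥤ ModuleCat.{v} B
  TP_projective : ∀ X : ModuleCat.{v} A, Projective (TP.obj X)
  TQ_projective : ∀ Y : ModuleCat.{v} B, Projective (TQ.obj Y)
  TP_fg : ∀ X : ModuleCat.{v} A, Module.Finite A X → Module.Finite A (TP.obj X)
  TQ_fg : ∀ Y : ModuleCat.{v} B, Module.Finite B Y → Module.Finite B (TQ.obj Y)
  iso₁ : F ⋙ H ≅ biprodFunctor (𝟭 (ModuleCat.{v} A)) TP
  iso₂ : H ⋙ F ≅ biprodFunctor (𝟭 (ModuleCat.{v} B)) TQ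
  fg_F : ∀ X : ModuleCat.{v} A, Module.Finite A X → Module.Finite B (F.obj X)
  fg_H : ∀ Y : ModuleCat.{v} B, Module.Finite B Y → Module.Finite A (H.obj Y)

end MoritaType

/-- Every finitely generated `A`-module has Gorenstein projective dimension at most `n`. -/
def FGGgldimLE (A : Type u₁) [Ring A] (n : ℕ) : Prop :=
  ∀ X : ModuleCat.{v} A, Module.Finite A X → fgGpdLE n X

section GorensteinProjectiveClosure

variable {A : Type u₁} [Ring A]

lemma IsFGGorensteinProjective.of_iso {X Y : ModuleCat.{v} A} (e : X ≅ Y)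
    (h : IsFGGorensteinProjective X) : IsFGGorensteinProjective Y := by
  obtain ⟨hX, P, d, hP, n, ⟨f⟩⟩ := h
  exact ⟨Module.Finite.equiv e.toLinearEquiv, P, d, hP, n, ⟨e.symm ≪≫ f⟩⟩

/-- A degreewise retract, through chain maps, of a totally acyclic complex is totally acyclic. -/
lemma IsFGTotallyAcyclic.of_retract {P P' : ℤ → ModuleCat.{v} A}
    {d : ∀ n : ℤ, P n ⟶ P (n + 1)} {d' : ∀ n : ℤ, P' n ⟶ P' (n + 1)}
    (h : IsFGTotallyAcyclic P d) (i : ∀ n, P' n ⟶ P n) (r : ∀ n, P n ⟶ P' n)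
    (ir : ∀ n, i n ≫ r n = 𝟙 _) (hi : ∀ n, i n ≫ d n = d' n ≫ i (n + 1))
    (hr : ∀ n, r n ≫ d' n = d n ≫ r (n + 1)) : IsFGTotallyAcyclic P' d' := by
  have hd' (n) : d' n = i n ≫ d n ≫ r (n + 1) := by
    rw [← hr, reassoc_of% ir]
  have hcomp (n) : d' n ≫ d' (n + 1) = 0 := by
    rw [hd' n, Category.assoc, Category.assoc, hr, reassoc_of% h.comp_eq_zero n]
    simp
  refine ⟨fun n => ?_, fun n => ?_, hcomp, fun n => ?_, fun Q hQ hQ' n => ?_⟩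
  · have := h.finite n
    refine Module.Finite.of_surjective (r n).hom fun x => ⟨(i n).hom x, ?_⟩
    exact ConcreteCategory.congr_hom (ir n) x
  · have := h.projective n
    exact (Retract.mk (i n) (r n) (ir n)).projective
  · rw [ShortComplex.moduleCat_exact_iff]
    intro x hx
    obtain ⟨y, hy⟩ := (ShortComplex.moduleCat_exact_iff _).1 (h.exact n) (i (n + 1) x) (by
      have := ConcreteCategory.congr_hom (hi (n + 1)) x
      simp at this hx
      simp [this, hx])
    refine ⟨r n y, ?_⟩
    have h1 := ConcreteCategory.congr_hom (hr n) y
    have h2 := ConcreteCategory.congr_hom (ir (n + 1)) x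
    simp at h1 h2 hy
    simp [h1, hy, h2]
  · intro g
    constructor
    · intro hg
      obtain ⟨f, hf⟩ := (h.hom_exact Q hQ hQ' n (r (n + 1) ≫ g)).1 (by
        simp only at hg ⊢
        rw [← reassoc_of% hr n, hg, comp_zero])
      refine ⟨i _ ≫ f, ?_⟩
      simp only at hf ⊢
      rw [← reassoc_of% hi, hf, reassoc_of% ir]
    · rintro ⟨f, rfl⟩
      simp only
      rw [reassoc_of% hcomp n, zero_comp]

/-- A projective direct summand inside the boundaries in degree `m + 1` of a complex can be split
off: the contractible subcomplex it generates is the image of an idempotent chain map. -/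
lemma exists_idempotent_chain_map {P : ℤ → ModuleCat.{v} A} {d : ∀ n : ℤ, P n ⟶ P (n + 1)}
    (hd : ∀ n, d n ≫ d (n + 1) = 0) {Q : ModuleCat.{v} A} {m : ℤ} (s : Q ⟶ P m)
    (r : P (m + 1) ⟶ Q) (hsr : s ≫ d m ≫ r = 𝟙 Q) :
    ∃ c : ∀ n, P n ⟶ P n, (∀ n, c n ≫ c n = c n) ∧ (∀ n, c n ≫ d n = d n ≫ c (n + 1)) ∧
      c (m + 1) = r ≫ s ≫ d m := by
  refine ⟨Function.update (Function.update 0 m (d m ≫ r ≫ s)) (m + 1) (r ≫ s ≫ d m),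
    fun n => ?_, fun n => ?_, by simp⟩
  · by_cases h1 : n = m + 1
    · subst h1
      simp [reassoc_of% hsr]
    by_cases h2 : n = m
    · subst h2
      simp [reassoc_of% hsr]
    simp [h1, h2]
  · by_cases h1 : n = m + 1
    · subst h1
      have : Function.update (0 : ∀ n, P n ⟶ P n) m (d m ≫ r ≫ s) (m + 1 + 1) = 0 :=
        Function.update_of_ne (by lia) _ _
      simp [hd, this]
    by_cases h2 : n = m
    · subst h2
      simp
    by_cases h3 : m = n + 1
    · subst h3
      simp [h1, h2, reassoc_of% hd n]
    simp [h1, h2, Ne.symm h3]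

/-- The kernel of an epimorphism from a Gorenstein projective module onto a projective module is
Gorenstein projective. -/
lemma IsFGGorensteinProjective.kernel_of_epi {G Q : ModuleCat.{v} A}
    (hG : IsFGGorensteinProjective G) (hQ : Module.Finite A Q) [Projective Q]
    (q : G ⟶ Q) [Epi q] : IsFGGorensteinProjective (kernel q) := by
  obtain ⟨hGfin, P, d, hP, n, ⟨e⟩⟩ := hG
  obtain ⟨j, rfl⟩ : ∃ j : ℤ, n = j + 1 + 1 := ⟨n - 2, by ring⟩
  have hd := hP.comp_eq_zero
  let t : P (j + 1) ⟶ G := kernel.lift _ _ (hd (j + 1)) ≫ e.inv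
  let a : G ⟶ P (j + 1 + 1) := e.hom ≫ kernel.ι _
  have ht : Epi t := by
    have : Epi (kernel.lift _ _ (hd (j + 1))) := (hP.exact (j + 1)).epi_kernelLift
    exact epi_comp _ _
  have hta : t ≫ a = d (j + 1) := by simp [t, a]
  have had : a ≫ d (j + 1 + 1) = 0 := by simp [a]
  have hdt : d j ≫ t = 0 := by
    rw [← cancel_mono a, Category.assoc, hta, hd, zero_comp]
  obtain ⟨r, hr⟩ := (hP.hom_exact Q hQ inferInstance j (t ≫ q)).1 (by
    simp [reassoc_of% hdt])
  replace hr : a ≫ r = q := by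
    rw [← cancel_epi t, reassoc_of% hta]
    exact hr
  let s : Q ⟶ P (j + 1) := Projective.factorThru (𝟙 Q) (t ≫ q)
  have hs : s ≫ t ≫ q = 𝟙 Q := Projective.factorThru_comp _ _
  obtain ⟨c, hcc, hcd, hc⟩ := exists_idempotent_chain_map hd s r (by
    rw [← hta, Category.assoc, hr, hs])
  let ι (n) := kernel.ι (c n)
  let π (n) : P n ⟶ kernel (c n) := kernel.lift _ (𝟙 _ - c n) (by simp [hcc])
  let d' (n) : kernel (c n) ⟶ kernel (c (n + 1)) :=
    kernel.lift _ (ι n ≫ d n) (by simp [ι, ← hcd])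
  have hP' : IsFGTotallyAcyclic _ d' := by
    refine hP.of_retract ι π (fun n => ?_) (fun n => ?_) fun n => ?_
    · rw [← cancel_mono (ι n)]
      simp [ι, π]
    · simp [d', ι]
    · rw [← cancel_mono (ι (n + 1))]
      simp [d', ι, π, hcd]
  have hker : kernel.ι q ≫ a ≫ c (j + 1 + 1) = 0 := by
    rw [hc, reassoc_of% hr, kernel.condition_assoc, zero_comp]
  have hw : (kernel.ι (d' (j + 1 + 1)) ≫ ι _) ≫ d (j + 1 + 1) = 0 := by
    have : ι _ ≫ d (j + 1 + 1) = d' _ ≫ ι _ := by simp [d', ι]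
    rw [Category.assoc, this, kernel.condition_assoc, zero_comp]
  let b : kernel (d' (j + 1 + 1)) ⟶ G := kernel.lift _ _ hw ≫ e.inv
  have hba : b ≫ a = kernel.ι _ ≫ ι _ := by simp [b, a]
  have hbq : b ≫ q = 0 := by
    have hcr : c _ ≫ r = r ≫ s ≫ t ≫ q := by
      rw [hc, ← hta, ← hr]
      simp
    have h0 : (b ≫ a) ≫ c _ = 0 := by simp [hba, ι]
    calc b ≫ q = (b ≫ a) ≫ r ≫ s ≫ t ≫ q := by rw [hs, ← hr]; simp
      _ = ((b ≫ a) ≫ c _) ≫ r := by rw [← hcr, Category.assoc (b ≫ a)]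
      _ = 0 := by rw [h0, zero_comp]
  have : Mono a := mono_comp _ _
  have : Mono (ι (j + 1 + 1)) := inferInstanceAs (Mono (kernel.ι _))
  refine ⟨?_, _, d', hP', j + 1 + 1, ⟨?_⟩⟩
  · refine Module.Finite.of_surjective
      (kernel.lift q (𝟙 G - q ≫ s ≫ t) (by simp [hs])).hom fun x => ⟨kernel.ι q x, ?_⟩
    have : kernel.ι q ≫ kernel.lift q (𝟙 G - q ≫ s ≫ t) (by simp [hs]) = 𝟙 _ := by
      rw [← cancel_mono (kernel.ι q)]
      simp
    exact ConcreteCategory.congr_hom this x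
  · refine ⟨kernel.lift _ (kernel.lift _ (kernel.ι q ≫ a) (by simpa using hker)) ?_,
      kernel.lift _ b hbq, ?_, ?_⟩
    · rw [← cancel_mono (ι _)]
      simp [d', ι, had]
    · rw [← cancel_mono (kernel.ι q), ← cancel_mono a]
      simp [hba, ι]
    · rw [← cancel_mono (kernel.ι _), ← cancel_mono (ι _), Category.assoc, Category.assoc, ← hba]
      simp [hba, ι]

lemma fgGpdLE.of_shortExact {n : ℕ} {S : ShortComplex (ModuleCat.{v} A)} (hS : S.ShortExact)
    (h₃ : Module.Finite A S.X₃) [Projective S.X₃] (h : fgGpdLE n S.X₂) : fgGpdLE n S.X₁ := by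
  have := hS.epi_g
  cases n with
  | zero =>
    exact (h.kernel_of_epi h₃ S.g).of_iso
      (hS.fIsKernel.conePointUniqueUpToIso (kernelIsKernel S.g)).symm
  | succ n =>
    obtain ⟨K, G, i, p, w, hG, hse, hK⟩ := h
    have := hse.epi_g
    have := hse.mono_f
    have := hS.mono_f
    dsimp at *
    let i' : K ⟶ kernel (p ≫ S.g) := kernel.lift _ i (by rw [reassoc_of% w, zero_comp])
    let p' : kernel (p ≫ S.g) ⟶ S.X₁ :=
      hS.exact.lift (kernel.ι (p ≫ S.g) ≫ p) (by simp)
    have hp' : p' ≫ S.f = kernel.ι (p ≫ S.g) ≫ p := hS.exact.lift_f _ _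
    have hi' : i' ≫ kernel.ι _ = i := kernel.lift_ι _ _ _
    have w' : i' ≫ p' = 0 := by
      rw [← cancel_mono S.f, Category.assoc, hp', reassoc_of% hi', w, zero_comp]
    refine ⟨K, _, i', p', w', hG.kernel_of_epi h₃ (p ≫ S.g), ?_, hK⟩
    have : Mono i' := mono_of_mono_fac hi'
    have : Epi p' := by
      rw [ModuleCat.epi_iff_surjective]
      intro x
      obtain ⟨g, hg⟩ := (ModuleCat.epi_iff_surjective p).1 inferInstance (S.f x)
      obtain ⟨y, hy⟩ := (ShortComplex.moduleCat_exact_iff _).1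
        (ShortComplex.exact_kernel (p ≫ S.g)) g (by
          simp [hg])
      refine ⟨y, (ModuleCat.mono_iff_injective S.f).1 inferInstance ?_⟩
      have := ConcreteCategory.congr_hom hp' y
      simp at this hy
      simp [this, hy, hg]
    refine ⟨?_⟩
    rw [ShortComplex.moduleCat_exact_iff]
    intro x hx
    obtain ⟨y, hy⟩ := (ShortComplex.moduleCat_exact_iff _).1 hse.exact (kernel.ι (p ≫ S.g) x) (by
      have := ConcreteCategory.congr_hom hp' x
      simp at this hx
      simp [← this, hx])
    refine ⟨y, (ModuleCat.mono_iff_injective (kernel.ι (p ≫ S.g))).1 inferInstance ?_⟩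
    have := ConcreteCategory.congr_hom hi' y
    simp at this hy
    simp [this, hy]

end GorensteinProjectiveClosure

namespace StableEquivMoritaAdjointType

variable {A : Type u₁} [Ring A] {B : Type u₂} [Ring B]
  {F : ModuleCat.{v} A ⥤ ModuleCat.{v} B} {H : ModuleCat.{v} B ⥤ ModuleCat.{v} A}

/-- The stable equivalence in the opposite direction. -/
def symm (sem : StableEquivMoritaAdjointType A B F H) : StableEquivMoritaAdjointType B A H F where
  adj₁ := sem.adj₂
  adj₂ := sem.adj₁
  TP := sem.TQ
  TQ := sem.TP
  TP_projective := sem.TQ_projective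
  TQ_projective := sem.TP_projective
  TP_fg := sem.TQ_fg
  TQ_fg := sem.TP_fg
  iso₁ := sem.iso₂
  iso₂ := sem.iso₁
  fg_F := sem.fg_H
  fg_H := sem.fg_F

lemma preservesFiniteLimits (sem : StableEquivMoritaAdjointType A B F H) :
    PreservesFiniteLimits F :=
  have := sem.adj₂.rightAdjoint_preservesLimits
  inferInstance

lemma preservesFiniteColimits (sem : StableEquivMoritaAdjointType A B F H) :
    PreservesFiniteColimits F :=
  have := sem.adj₁.leftAdjoint_preservesColimits
  inferInstance

lemma projective_obj (sem : StableEquivMoritaAdjointType A B F H) {X : ModuleCat.{v} A}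
    (hX : Projective X) : Projective (F.obj X) :=
  have := sem.adj₂.leftAdjoint_preservesColimits
  sem.adj₁.map_projective X hX

lemma isFGTotallyAcyclic [F.Additive] [H.Additive] (sem : StableEquivMoritaAdjointType A B F H)
    {P : ℤ → ModuleCat.{v} A} {d : ∀ n : ℤ, P n ⟶ P (n + 1)} (hP : IsFGTotallyAcyclic P d) :
    IsFGTotallyAcyclic (fun n => F.obj (P n)) (fun n => F.map (d n)) := by
  have := sem.preservesFiniteLimits
  have := sem.preservesFiniteColimits
  refine ⟨fun n => sem.fg_F _ (hP.finite n), fun n => sem.projective_obj (hP.projective n),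
    fun n => by rw [← F.map_comp, hP.comp_eq_zero, F.map_zero],
    fun n => (hP.exact n).map F, fun Q hQ hQ' n g => ?_⟩
  have key := hP.hom_exact (H.obj Q) (sem.fg_H Q hQ) (sem.symm.projective_obj hQ') n
    (sem.adj₁.homEquiv _ _ g)
  constructor
  · intro hg
    obtain ⟨f, hf⟩ := key.1 (by
      simp only at hg ⊢
      rw [← sem.adj₁.homEquiv_naturality_left, hg]
      simp [Adjunction.homEquiv_unit])
    refine ⟨(sem.adj₁.homEquiv _ _).symm f, ?_⟩
    simp only at hf ⊢
    rw [← sem.adj₁.homEquiv_naturality_left_symm, hf, Equiv.symm_apply_apply]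
  · rintro ⟨f, rfl⟩
    simp only
    rw [← F.map_comp_assoc, hP.comp_eq_zero, F.map_zero, zero_comp]

lemma isFGGorensteinProjective [F.Additive] [H.Additive]
    (sem : StableEquivMoritaAdjointType A B F H) {X : ModuleCat.{v} A}
    (hX : IsFGGorensteinProjective X) : IsFGGorensteinProjective (F.obj X) := by
  have := sem.preservesFiniteLimits
  obtain ⟨hfin, P, d, hP, n, ⟨e⟩⟩ := hX
  exact ⟨sem.fg_F X hfin, _, _, sem.isFGTotallyAcyclic hP, n,
    ⟨F.mapIso e ≪≫ PreservesKernel.iso F (d n)⟩⟩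

lemma fgGpdLE_obj [F.Additive] [H.Additive] (sem : StableEquivMoritaAdjointType A B F H) {n : ℕ}
    {X : ModuleCat.{v} A} (hX : fgGpdLE n X) : fgGpdLE n (F.obj X) := by
  have := sem.preservesFiniteLimits
  have := sem.preservesFiniteColimits
  induction n generalizing X with
  | zero => exact sem.isFGGorensteinProjective hX
  | succ n ih =>
    obtain ⟨K, G, i, p, w, hG, hse, hK⟩ := hX
    exact ⟨_, _, F.map i, F.map p, by rw [← F.map_comp, w, F.map_zero],
      sem.isFGGorensteinProjective hG, hse.map_of_exact F, ih hK⟩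

lemma fgGgldimLE [F.Additive] [H.Additive] (sem : StableEquivMoritaAdjointType A B F H) {n : ℕ}
    (hA : FGGgldimLE.{v} A n) : FGGgldimLE.{v} B n := by
  intro Y hY
  have e : F.obj (H.obj Y) ≅ Y ⊞ sem.TQ.obj Y := sem.iso₂.app Y
  let S := ShortComplex.mk (biprod.inl ≫ e.inv) (e.hom ≫ biprod.snd : _ ⟶ sem.TQ.obj Y) (by simp)
  have hS : S.ShortExact := ShortComplex.Splitting.shortExact
    { r := e.hom ≫ biprod.fst
      s := biprod.inr ≫ e.inv
      f_r := by simp [S]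
      s_g := by simp [S]
      id := by
        rw [← cancel_epi e.inv, ← cancel_mono e.hom]
        simp [S] }
  have : Projective S.X₃ := sem.TQ_projective Y
  exact fgGpdLE.of_shortExact hS (sem.TQ_fg Y hY) (sem.fgGpdLE_obj (hA _ (sem.fg_H Y hY)))

end StableEquivMoritaAdjointType

/-- part of Corollary 5.7 of the paper. Suppose bimodules `_B M _A` and
`_A N _B` define a stable equivalence of Morita type of adjoint type between finite
dimensional `k`-algebras `A` and `B`, encoded via the tensor functors `F = M ⊗_A -` and
`H = N ⊗_B -`. Then `A` is Gorenstein (there is an `n` bounding the Gorenstein projective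
dimension of all finitely generated `A`-modules) if and only if `B` is Gorenstein, and in
that case the global Gorenstein dimensions (the least such `n`) of `A` and `B` coincide. -/
theorem morita_adjoint_type_gorenstein_iff
    {k : Type u₁} [Field k]
    {A : Type u₁} [Ring A] [Algebra k A] [FiniteDimensional k A]
    {B : Type u₂} [Ring B] [Algebra k B] [FiniteDimensional k B]
    (F : ModuleCat.{v} A ⥤ ModuleCat.{v} B) (H : ModuleCat.{v} B ⥤ ModuleCat.{v} A)
    [F.Additive] [H.Additive]
    (sem : StableEquivMoritaAdjointType A B F H) :
    ((∃ n, FGGgldimLE.{v} A n) ↔ (∃ n, FGGgldimLE.{v} B n)) ∧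
      ((∃ n, FGGgldimLE.{v} A n) →
        sInf {n : ℕ | FGGgldimLE.{v} A n} = sInf {n : ℕ | FGGgldimLE.{v} B n}) := by
  have hset : {n : ℕ | FGGgldimLE.{v} A n} = {n : ℕ | FGGgldimLE.{v} B n} :=
    Set.ext fun _ => ⟨sem.fgGgldimLE, sem.symm.fgGgldimLE⟩
  exact ⟨exists_congr fun n => Set.ext_iff.mp hset n, fun _ => congrArg sInf hset⟩
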